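/- Let K be a field, k ≥ 1, and n = 2k−1. If there exists a field extension F of K with [F : K] = k (i.e., F is a field that is a K-algebra of dimension k over K), then there exists a K-subspace C ≤ U^n(K) with dim_K(C) = k such that every nonzero Δ ∈ C satisfies frk(Δ) = k². -/

import Mathlib

/-- The space `U^n(K)` of upper triangular `n × n` matrices over `K`,
as a `K`-subspace of the matrix space. -/
def UT (K : Type*) [Field K] (n : ℕ) : Submodule K (Matrix (Fin n) (Fin n) K) where
  carrier := {A | ∀ i j : Fin n, (j : ℕ) < (i : ℕ) → A i j = 0}
  add_mem' := by
    intro a b ha hb i j h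
    simp [Matrix.add_apply, ha i j h, hb i j h]
  zero_mem' := by
    intro i j h
    simp
  smul_mem' := by
    intro c a ha i j h
    simp [Matrix.smul_apply, ha i j h]

/-- For `Δ ∈ U^n(K)` and `i : Fin n` (representing the 1-indexed value `i+1`),
the upper-right corner submatrix `Δ_[i+1] ∈ K^{(i+1) × (n+1-(i+1))}`,
consisting of the entries `Δ_{k,ℓ}` with (1-indexed) `1 ≤ k ≤ i+1`, `i+1 ≤ ℓ ≤ n`. -/
def corner {K : Type*} [Field K] {n : ℕ} (Δ : Matrix (Fin n) (Fin n) K) (i : Fin n) :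
    Matrix (Fin ((i : ℕ) + 1)) (Fin (n + 1 - ((i : ℕ) + 1))) K :=
  Matrix.of fun k l =>
    Δ ⟨k, by have := k.isLt; have := i.isLt; omega⟩
      ⟨(i : ℕ) + l, by have := l.isLt; have := i.isLt; omega⟩

/-- The flag rank of an upper triangular matrix: the sum of the ranks of its
upper-right corner submatrices, `frk Δ = Σ_{i=1}^{n} rank Δ_[i]`. -/
noncomputable def frk {K : Type*} [Field K] {n : ℕ} (Δ : Matrix (Fin n) (Fin n) K) : ℕ :=
  ∑ i : Fin n, (corner Δ i).rank

open Module

/-- A matrix whose rows restrict, along a choice of columns, to distinct rows of an invertible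
matrix has full row rank. -/
theorem rank_eq_card_of_rows_of_isUnit {K m n p : Type*} [Field K] [Fintype m] [Fintype n]
    [Fintype p] [DecidableEq p] {A : Matrix m n K} {M : Matrix p p K} (hM : IsUnit M)
    {g : m → p} (hg : Function.Injective g) (f : p → n)
    (h : ∀ a b, A a (f b) = M (g a) b) : A.rank = Fintype.card m := by
  have hrows : LinearIndependent K (M.row ∘ g) :=
    (Matrix.linearIndependent_rows_of_isUnit hM).comp g hg
  have hcomp : M.row ∘ g = LinearMap.funLeft K K f ∘ A.row := by
    ext a b
    exact (h a b).symm
  rw [hcomp] at hrows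
  exact (LinearIndependent.of_comp _ hrows).rank_matrix

/-- A matrix whose columns restrict, along a choice of rows, to distinct columns of an invertible
matrix has full column rank. -/
theorem rank_eq_card_of_cols_of_isUnit {K m n p : Type*} [Field K] [Fintype m] [Fintype n]
    [Fintype p] [DecidableEq p] {A : Matrix m n K} {M : Matrix p p K} (hM : IsUnit M)
    {g : n → p} (hg : Function.Injective g) (f : p → m)
    (h : ∀ a b, A (f a) b = M a (g b)) : A.rank = Fintype.card n := by
  rw [← Matrix.rank_transpose]
  exact rank_eq_card_of_rows_of_isUnit (M := M.transpose) (by simpa using hM) hg f fun a b => h b a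

theorem sum_range_min_succ_sub (m : ℕ) :
    ∑ i ∈ Finset.range (2 * m + 1), min (i + 1) (2 * m + 1 - i) = (m + 1) ^ 2 := by
  induction m with
  | zero => simp
  | succ m ih =>
    rw [show 2 * (m + 1) + 1 = 2 * m + 1 + 1 + 1 by ring, Finset.sum_range_succ,
      Finset.sum_range_succ']
    have hmid : ∀ i ∈ Finset.range (2 * m + 1),
        min (i + 1 + 1) (2 * m + 1 + 1 + 1 - (i + 1)) = min (i + 1) (2 * m + 1 - i) + 1 := by
      intro i hi
      rw [Finset.mem_range] at hi
      omega
    rw [Finset.sum_congr rfl hmid, Finset.sum_add_distrib, ih, Finset.sum_const,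
      Finset.card_range, smul_eq_mul, Nat.sub_zero, min_eq_left (by omega),
      min_eq_right (by omega), show 2 * m + 1 + 1 + 1 - (2 * m + 1 + 1) = 1 by omega]
    ring

/-- The embedding of `k × k` matrices as the upper-right block, consisting of the first `k` rows
and the last `k` columns, of square matrices of size `2 * k - 1`. -/
def upperRightBlock (K : Type*) [Field K] (k : ℕ) :
    Matrix (Fin k) (Fin k) K →ₗ[K] Matrix (Fin (2 * k - 1)) (Fin (2 * k - 1)) K where
  toFun M := Matrix.of fun i j =>
    if h : (i : ℕ) < k ∧ k - 1 ≤ (j : ℕ) then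
      M ⟨i, h.1⟩ ⟨j - (k - 1), by have := j.isLt; omega⟩
    else 0
  map_add' M N := by
    ext i j
    simp only [Matrix.of_apply, Matrix.add_apply]
    split_ifs <;> simp
  map_smul' c M := by
    ext i j
    simp only [Matrix.of_apply, Matrix.smul_apply, RingHom.id_apply]
    split_ifs <;> simp

theorem upperRightBlock_apply {K : Type*} [Field K] {k : ℕ} (M : Matrix (Fin k) (Fin k) K)
    (a b : Fin k) {i j : Fin (2 * k - 1)} (hi : (i : ℕ) = a) (hj : (j : ℕ) = k - 1 + b) :
    upperRightBlock K k M i j = M a b := by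
  have h : (i : ℕ) < k ∧ k - 1 ≤ (j : ℕ) := ⟨hi ▸ a.isLt, by omega⟩
  simp only [upperRightBlock, LinearMap.coe_mk, AddHom.coe_mk, Matrix.of_apply, dif_pos h]
  exact congrArg₂ M (Fin.ext hi) (Fin.ext (by simp [hj]))

theorem upperRightBlock_mem_UT {K : Type*} [Field K] {k : ℕ} (M : Matrix (Fin k) (Fin k) K) :
    upperRightBlock K k M ∈ UT K (2 * k - 1) := by
  intro i j hij
  have h : ¬((i : ℕ) < k ∧ k - 1 ≤ (j : ℕ)) := by omega
  simp only [upperRightBlock, LinearMap.coe_mk, AddHom.coe_mk, Matrix.of_apply, dif_neg h]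

theorem upperRightBlock_injective (K : Type*) [Field K] (k : ℕ) :
    Function.Injective (upperRightBlock K k) := by
  intro M N h
  ext a b
  have ha := a.isLt
  have hb := b.isLt
  rw [← upperRightBlock_apply M a b (i := ⟨a, by omega⟩) (j := ⟨k - 1 + b, by omega⟩) rfl rfl, h,
    upperRightBlock_apply N a b rfl rfl]

theorem rank_corner_upperRightBlock {K : Type*} [Field K] {k : ℕ} {M : Matrix (Fin k) (Fin k) K}
    (hM : IsUnit M) (i : Fin (2 * k - 1)) :
    (corner (upperRightBlock K k M) i).rank = min ((i : ℕ) + 1) (2 * k - 1 - i) := by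
  have hi := i.isLt
  rcases lt_or_ge (i : ℕ) k with hik | hik
  · rw [rank_eq_card_of_rows_of_isUnit (A := corner (upperRightBlock K k M) i) hM
      (g := Fin.castLE hik) (Fin.castLE_injective _)
      (fun b => ⟨k - 1 + b - i, by have := b.isLt; omega⟩)
      (fun a b => upperRightBlock_apply M _ _ rfl ?_), Fintype.card_fin]
    · omega
    · change (i : ℕ) + (k - 1 + b - i) = k - 1 + b
      omega
  · rw [rank_eq_card_of_cols_of_isUnit (A := corner (upperRightBlock K k M) i) hM
      (g := fun b => ⟨i + b - (k - 1), by have := b.isLt; omega⟩) ?_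
      (Fin.castLE (by omega))
      (fun a b => upperRightBlock_apply M _ _ rfl ?_), Fintype.card_fin]
    · omega
    · intro b c hbc
      have := congrArg Fin.val hbc
      simp only at this
      exact Fin.ext (by omega)
    · change (i : ℕ) + b = k - 1 + (i + b - (k - 1))
      omega

theorem frk_upperRightBlock {K : Type*} [Field K] {k : ℕ} (hk : 1 ≤ k)
    {M : Matrix (Fin k) (Fin k) K} (hM : IsUnit M) : frk (upperRightBlock K k M) = k ^ 2 := by
  obtain ⟨m, rfl⟩ := Nat.exists_eq_add_of_le' hk
  rw [← sum_range_min_succ_sub m, frk,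
    Finset.sum_congr rfl fun i _ => rank_corner_upperRightBlock hM i,
    Fin.sum_univ_eq_sum_range fun i => min (i + 1) (2 * (m + 1) - 1 - i)]
  rfl


/-- Even case `n + 1 = 2k`: if `K` admits a field extension `F` of degree `k`, then
there is a flag rank metric code `C ≤ U^n(K)` of dimension `k` all of whose nonzero
elements have flag rank exactly `k²` (so with minimum distance `k²`). -/
theorem exists_maxdist_code_even {K : Type*} [Field K] (k : ℕ) (hk : 1 ≤ k)
    (F : Type*) [Field F] [Algebra K F] (hF : Module.finrank K F = k) :
    ∃ C : Submodule K (Matrix (Fin (2 * k - 1)) (Fin (2 * k - 1)) K),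
      C ≤ UT K (2 * k - 1) ∧ Module.finrank K ↥C = k ∧
        ∀ Δ ∈ C, Δ ≠ 0 → frk Δ = k ^ 2 := by
  have : FiniteDimensional K F := FiniteDimensional.of_finrank_pos (hF ▸ hk)
  let b : Basis (Fin k) K F := finBasisOfFinrankEq K F hF
  let φ := upperRightBlock K k ∘ₗ (Algebra.leftMulMatrix b).toLinearMap
  have hφ : Function.Injective φ :=
    (upperRightBlock_injective K k).comp (Algebra.leftMulMatrix_injective b)
  refine ⟨LinearMap.range φ, ?_, (LinearMap.finrank_range_of_inj hφ).trans hF, ?_⟩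
  · rintro _ ⟨x, rfl⟩
    exact upperRightBlock_mem_UT _
  · rintro _ ⟨x, rfl⟩ hx
    have hx0 : x ≠ 0 := fun h => hx (by rw [h, map_zero])
    exact frk_upperRightBlock hk (hx0.isUnit.map (Algebra.leftMulMatrix b))
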